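/- Let S be a C-semigroup in ℕ^d (d ≥ 2) with full cone, let ≺ be a term order on ℕ^d such that every element of ℕ^d is preceded by only finitely many elements, and suppose S is ≺-almost symmetric with Betti-type three, i.e., |PF(S)| = 3. Then S satisfies the extended Wilf inequality: |{g ∈ S : g ≺ F(S)_≺}|·e(S) ≥ N(F(S)_≺) + 1, where N(F(S)_≺) = |H(S)| + |{g ∈ S : g ≺ F(S)_≺}|. -/

import Mathlib

open Set

/-- Membership in the rational cone spanned by `S` inside `ℚ^d`. -/
def memCone {d : ℕ} (S : Set (Fin d → ℕ)) (x : Fin d → ℚ) : Prop :=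
  ∃ (n : ℕ) (c : Fin n → ℚ) (v : Fin n → (Fin d → ℕ)),
    (∀ i, 0 ≤ c i) ∧ (∀ i, v i ∈ S) ∧ x = ∑ i, c i • (fun j => ((v i j : ℚ)))

/-- `cone(S) ∩ ℕ^d`, viewed as a subset of `ℕ^d`. -/
def coneN {d : ℕ} (S : Set (Fin d → ℕ)) : Set (Fin d → ℕ) :=
  {x | memCone S (fun j => ((x j : ℚ)))}

/-- `H(S) = (cone(S) \ S) ∩ ℕ^d`. -/
def Hset {d : ℕ} (S : Set (Fin d → ℕ)) : Set (Fin d → ℕ) := coneN S \ S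

/-- The set of pseudo-Frobenius elements of `S`. -/
def pfSet {d : ℕ} (S : Set (Fin d → ℕ)) : Set (Fin d → ℕ) :=
  {f | f ∈ Hset S ∧ ∀ s ∈ S, s ≠ 0 → f + s ∈ S}

/-- A term order on `ℕ^d`: a strict total order compatible with addition. -/
def IsTermOrder {d : ℕ} (prec : (Fin d → ℕ) → (Fin d → ℕ) → Prop) : Prop :=
  (∀ a, ¬ prec a a) ∧ (∀ a b c, prec a b → prec b c → prec a c) ∧
    (∀ a b, a ≠ b → prec a b ∨ prec b a) ∧
    (∀ a b c, prec a b → prec (a + c) (b + c))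

/-- `F` is the maximum of `H(S)` with respect to the term order `prec`. -/
def IsFrob {d : ℕ} (S : Set (Fin d → ℕ)) (prec : (Fin d → ℕ) → (Fin d → ℕ) → Prop)
    (F : Fin d → ℕ) : Prop :=
  F ∈ Hset S ∧ ∀ h ∈ Hset S, h ≠ F → prec h F

/-- A `C`-semigroup: a finitely generated submonoid of `ℕ^d` with
`H(S)` nonempty and finite. -/
def CSemigroup {d : ℕ} (S : AddSubmonoid (Fin d → ℕ)) : Prop :=
  S.FG ∧ (Hset (S : Set (Fin d → ℕ))).Nonempty ∧ (Hset (S : Set (Fin d → ℕ))).Finite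

/-- `T` is an ideal of `S`: a subset of `cone(S) ∩ ℕ^d` with `S + T ⊆ T`. -/
def IsIdeal {d : ℕ} (S T : Set (Fin d → ℕ)) : Prop :=
  T ⊆ coneN S ∧ ∀ s ∈ S, ∀ t ∈ T, s + t ∈ T

/-- `Ω_≺ = {z ∈ cone(S) ∩ ℕ^d : F(S)_≺ − z ∉ S}` (the condition `F − z ∉ S`
is expressed as: there is no `w ∈ S` with `z + w = F`). -/
def omegaSet {d : ℕ} (S : Set (Fin d → ℕ)) (F : Fin d → ℕ) : Set (Fin d → ℕ) :=
  {z ∈ coneN S | ¬ ∃ w ∈ S, z + w = F}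

/-- `S` is `≺`-almost symmetric (with Frobenius element `F`):
`PF'(S) = PF(S) \ {F}` is nonempty and `F − g ∈ PF'(S)` for every `g ∈ PF'(S)`. -/
def AlmostSym {d : ℕ} (S : Set (Fin d → ℕ)) (F : Fin d → ℕ) : Prop :=
  (pfSet S \ {F}).Nonempty ∧ ∀ g ∈ pfSet S \ {F}, ∃ w ∈ pfSet S \ {F}, g + w = F

/-- The unique minimal generating set of a submonoid of `ℕ^d`:
the nonzero elements that are not sums of two nonzero elements. -/
def minGens {d : ℕ} (S : Set (Fin d → ℕ)) : Set (Fin d → ℕ) :=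
  {s ∈ S | s ≠ 0 ∧ ¬ ∃ x ∈ S, ∃ y ∈ S, x ≠ 0 ∧ y ≠ 0 ∧ x + y = s}

/-- An element of `S` outside a submonoid `T` dominates a minimal generator outside `T`. -/
theorem exists_minGens_le_notMem {d : ℕ} (S T : AddSubmonoid (Fin d → ℕ))
    (x : Fin d → ℕ) (hx : x ∈ S) (hxT : x ∉ T) :
    ∃ u ∈ minGens (S : Set (Fin d → ℕ)), u ≤ x ∧ u ∉ T := by
  induction x using WellFoundedLT.induction with
  | ind x ih =>
    by_cases hmin : x ∈ minGens (S : Set (Fin d → ℕ))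
    · exact ⟨x, hmin, le_rfl, hxT⟩
    have hx0 : x ≠ 0 := fun h => hxT (h ▸ T.zero_mem)
    have hdec : ∃ a ∈ S, ∃ b ∈ S, a ≠ 0 ∧ b ≠ 0 ∧ a + b = x := by
      by_contra h
      exact hmin ⟨hx, hx0, h⟩
    obtain ⟨a, ha, b, hb, ha0, hb0, rfl⟩ := hdec
    by_cases haT : a ∈ T
    · have hbT : b ∉ T := fun h => hxT (T.add_mem haT h)
      have hlt : b < a + b := lt_add_of_pos_left b (pos_iff_ne_zero.2 ha0)
      obtain ⟨u, hu, hub, huT⟩ := ih b hlt hb hbT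
      exact ⟨u, hu, hub.trans hlt.le, huT⟩
    · have hlt : a < a + b := lt_add_of_pos_right a (pos_iff_ne_zero.2 hb0)
      obtain ⟨u, hu, hua, huT⟩ := ih a hlt ha haT
      exact ⟨u, hu, hua.trans hlt.le, huT⟩

/-- Every nonzero element of `S` dominates a minimal generator. -/
theorem exists_minGens_le {d : ℕ} (S : AddSubmonoid (Fin d → ℕ))
    (x : Fin d → ℕ) (hx : x ∈ S) (hx0 : x ≠ 0) :
    ∃ u ∈ minGens (S : Set (Fin d → ℕ)), u ≤ x := by
  obtain ⟨u, hu, hux, -⟩ := exists_minGens_le_notMem S ⊥ x hx (by simpa using hx0)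
  exact ⟨u, hu, hux⟩

/-- A finitely generated submonoid of `ℕ^d` has finitely many minimal generators. -/
theorem minGens_finite {d : ℕ} {S : AddSubmonoid (Fin d → ℕ)} (hS : S.FG) :
    (minGens (S : Set (Fin d → ℕ))).Finite := by
  obtain ⟨G, rfl⟩ := hS
  refine G.finite_toSet.subset fun s hs => ?_
  have key : s = 0 ∨ s ∈ (G : Set (Fin d → ℕ)) ∨
      ∃ x ∈ AddSubmonoid.closure (G : Set (Fin d → ℕ)),
        ∃ y ∈ AddSubmonoid.closure (G : Set (Fin d → ℕ)), x ≠ 0 ∧ y ≠ 0 ∧ x + y = s := by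
    refine AddSubmonoid.closure_induction
      (motive := fun s _ => s = 0 ∨ s ∈ (G : Set (Fin d → ℕ)) ∨
        ∃ x ∈ AddSubmonoid.closure (G : Set (Fin d → ℕ)),
          ∃ y ∈ AddSubmonoid.closure (G : Set (Fin d → ℕ)), x ≠ 0 ∧ y ≠ 0 ∧ x + y = s)
      ?_ ?_ ?_ hs.1
    · exact fun x hx => Or.inr (Or.inl hx)
    · exact Or.inl rfl
    · intro x y hx hy ihx ihy
      by_cases hx0 : x = 0
      · simpa [hx0] using ihy
      by_cases hy0 : y = 0
      · simpa [hy0] using ihx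
      exact Or.inr (Or.inr ⟨x, hx, y, hy, hx0, hy0, rfl⟩)
  rcases key with h | h | h
  · exact absurd h hs.2.1
  · exact h
  · exact absurd h hs.2.2

/-- If `S` has finite complement, then all far enough points of a line parallel to an axis
belong to `S`. -/
theorem exists_add_single_mem {d : ℕ} {S : AddSubmonoid (Fin d → ℕ)}
    (hS : ((S : Set (Fin d → ℕ))ᶜ).Finite) (x : Fin d → ℕ) (i : Fin d) :
    ∃ N, ∀ k, N ≤ k → x + (Pi.single i k : Fin d → ℕ) ∈ S := by
  obtain ⟨B, hB⟩ := (hS.image fun y => y i).bddAbove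
  refine ⟨B + 1, fun k hk => ?_⟩
  by_contra h
  have h1 : (x + (Pi.single i k : Fin d → ℕ)) i ≤ B := hB ⟨_, h, rfl⟩
  simp at h1
  omega

theorem exists_single_mem {d : ℕ} {S : AddSubmonoid (Fin d → ℕ)}
    (hS : ((S : Set (Fin d → ℕ))ᶜ).Finite) (i : Fin d) :
    ∃ N, ∀ k, N ≤ k → Pi.single i k ∈ S := by
  simpa using exists_add_single_mem hS 0 i

theorem eq_single_of_le {d : ℕ} {u : Fin d → ℕ} {i : Fin d} {k : ℕ}
    (h : u ≤ Pi.single i k) : u = Pi.single i (u i) := by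
  funext l
  by_cases hl : l = i
  · subst hl; simp
  · have := h l
    simp [hl] at this ⊢
    exact this

/-- If the `i`-th unit vector is a gap, there are two minimal generators on the `i`-th axis. -/
theorem exists_two_minGens_axis {d : ℕ} {S : AddSubmonoid (Fin d → ℕ)}
    (hS : ((S : Set (Fin d → ℕ))ᶜ).Finite) {i : Fin d} (hi : Pi.single i 1 ∉ S) :
    ∃ a b : ℕ, a ≠ b ∧ a ≠ 0 ∧ b ≠ 0 ∧ Pi.single i a ∈ minGens (S : Set (Fin d → ℕ)) ∧
      Pi.single i b ∈ minGens (S : Set (Fin d → ℕ)) := by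
  obtain ⟨N, hN⟩ := exists_single_mem hS i
  obtain ⟨u, hu, hule⟩ := exists_minGens_le S _ (hN (N + 1) (by omega)) (by simp)
  have hui := eq_single_of_le hule
  have hu1 : u i ≠ 1 := fun h => hi (by rw [← h, ← hui]; exact hu.1)
  have hu0 : u i ≠ 0 := fun h => hu.2.1 (by rw [hui, h, Pi.single_zero])
  have hmul : ∀ k, Pi.single i k ∈ AddSubmonoid.multiples u → u i ∣ k := by
    rintro k ⟨m, hm⟩
    have h2 := congrFun hm i
    simp at h2
    exact ⟨m, by rw [← h2, mul_comm]⟩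
  have hk : ∃ k, N ≤ k ∧ Pi.single i k ∉ AddSubmonoid.multiples u := by
    by_contra! h
    have h1 := hmul _ (h N le_rfl)
    have h2 := hmul _ (h (N + 1) (by omega))
    exact hu1 (Nat.dvd_one.1 ((Nat.dvd_add_right h1).1 h2))
  obtain ⟨k, hNk, hk⟩ := hk
  obtain ⟨v, hv, hvle, hvT⟩ := exists_minGens_le_notMem S _ _ (hN k hNk) hk
  have hvi := eq_single_of_le hvle
  have hv0 : v i ≠ 0 := fun h => hv.2.1 (by rw [hvi, h, Pi.single_zero])
  refine ⟨u i, v i, fun h => hvT ?_, hu0, hv0, hui ▸ hu, hvi ▸ hv⟩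
  rw [hvi, ← h, ← hui]
  exact AddSubmonoid.mem_multiples u

theorem eq_top_of_single_mem {d : ℕ} {S : AddSubmonoid (Fin d → ℕ)}
    (h : ∀ i, Pi.single i 1 ∈ S) : S = ⊤ := by
  refine eq_top_iff.2 fun x _ => ?_
  have hx : x = ∑ i, x i • (Pi.single i 1 : Fin d → ℕ) := by
    funext l
    simp [Finset.sum_apply, Pi.single_apply]
  rw [hx]
  exact S.sum_mem fun i _ => S.nsmul_mem (h i) _

/-- A proper submonoid of `ℕ^d`, `d ≥ 2`, with finite complement has at least four
minimal generators. -/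
theorem four_le_ncard_minGens {d : ℕ} (hd : 2 ≤ d) {S : AddSubmonoid (Fin d → ℕ)}
    (hS : ((S : Set (Fin d → ℕ))ᶜ).Finite) (hne : S ≠ ⊤)
    (hfin : (minGens (S : Set (Fin d → ℕ))).Finite) :
    4 ≤ (minGens (S : Set (Fin d → ℕ))).ncard := by
  obtain ⟨i, hi⟩ : ∃ i, Pi.single i 1 ∉ S := by
    by_contra! h
    exact hne (eq_top_of_single_mem h)
  have : Nontrivial (Fin d) := Fin.nontrivial_iff_two_le.2 hd
  obtain ⟨j, hji⟩ := exists_ne i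
  obtain ⟨a, b, hab, ha0, hb0, ha, hb⟩ := exists_two_minGens_axis hS hi
  suffices h : ∃ u v : Fin d → ℕ, u ≠ v ∧ u j ≠ 0 ∧ v j ≠ 0 ∧
      u ∈ minGens (S : Set (Fin d → ℕ)) ∧ v ∈ minGens (S : Set (Fin d → ℕ)) by
    obtain ⟨u, v, huv, hu0, hv0, hu, hv⟩ := h
    have hoff : ∀ (c : ℕ) (w : Fin d → ℕ), w j ≠ 0 → Pi.single i c ≠ w := by
      rintro c w hw rfl
      simp [hji] at hw
    have habs : (Pi.single i a : Fin d → ℕ) ≠ Pi.single i b := fun h =>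
      hab (Pi.single_injective i h)
    have hcard : ({Pi.single i a, Pi.single i b, u, v} : Set (Fin d → ℕ)).ncard = 4 := by
      rw [Set.ncard_insert_of_notMem, Set.ncard_insert_of_notMem, Set.ncard_pair huv]
      · simp [hoff b u hu0, hoff b v hv0]
      · simp [habs, hoff a u hu0, hoff a v hv0]
    rw [← hcard]
    refine Set.ncard_le_ncard ?_ hfin
    rintro w (rfl | rfl | rfl | rfl) <;> assumption
  by_cases hj : Pi.single j 1 ∈ S
  · obtain ⟨N, hN⟩ := exists_add_single_mem hS (Pi.single i 1) j
    let T : AddSubmonoid (Fin d → ℕ) := (⊥ : AddSubmonoid ℕ).comap (Pi.evalAddMonoidHom _ i)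
    have hT : ∀ x, x ∈ T ↔ x i = 0 := fun x => by simp [T]
    obtain ⟨u, hu, hule, huT⟩ := exists_minGens_le_notMem S T _ (hN N le_rfl)
      (by simp [hT])
    obtain ⟨v, hv, hvle⟩ := exists_minGens_le S _ hj (by simp)
    have hvj := eq_single_of_le hvle
    rw [hT] at huT
    refine ⟨u, v, ?_, ?_, ?_, hu, hv⟩
    · rintro rfl
      have := hvle i
      simp [hji.symm] at this
      exact huT this
    · intro hu0
      have hu1 : u = Pi.single i 1 := by
        funext l
        have h1 := hule l
        by_cases hl : l = i
        · subst hl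
          simp [hji.symm] at h1 ⊢
          omega
        · by_cases hlj : l = j
          · subst hlj; simp [hl, hu0]
          · simpa [hl, hlj] using h1
      exact hi (hu1 ▸ hu.1)
    · exact fun h => hv.2.1 (by rw [hvj, h, Pi.single_zero])
  · obtain ⟨p, q, hpq, hp0, hq0, hp, hq⟩ := exists_two_minGens_axis hS hj
    exact ⟨_, _, fun h => hpq (Pi.single_injective j h), by simpa, by simpa, hp, hq⟩

/-- In a term order all of whose initial segments are finite, `0` is the least element. -/
theorem IsTermOrder.zero_prec {d : ℕ} {prec : (Fin d → ℕ) → (Fin d → ℕ) → Prop}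
    (hprec : IsTermOrder prec) (hfin : ∀ x : Fin d → ℕ, {g | prec g x}.Finite)
    {x : Fin d → ℕ} (hx : x ≠ 0) : prec 0 x := by
  obtain ⟨-, htrans, htri, hadd⟩ := hprec
  refine (htri 0 x hx.symm).resolve_right fun h => ?_
  have hmul : ∀ k : ℕ, prec ((k + 1) • x) 0 := by
    intro k
    induction k with
    | zero => simpa using h
    | succ k ih =>
      have h1 := hadd _ _ x ih
      rw [zero_add, ← succ_nsmul] at h1
      exact htrans _ _ _ h1 h
  refine Set.infinite_of_injective_forall_mem (f := fun k : ℕ => (k + 1) • x) ?_ hmul (hfin 0)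
  intro k l hkl
  obtain ⟨i, hi⟩ := Function.ne_iff.1 hx
  have h1 := congrFun hkl i
  simp only [Pi.smul_apply, smul_eq_mul] at h1
  have := Nat.eq_of_mul_eq_mul_right (Nat.pos_of_ne_zero hi) h1
  omega

/-- A nonempty set has a least element for a term order with finite initial segments. -/
theorem IsTermOrder.exists_min {d : ℕ} {prec : (Fin d → ℕ) → (Fin d → ℕ) → Prop}
    (hprec : IsTermOrder prec) (hfin : ∀ x : Fin d → ℕ, {g | prec g x}.Finite)
    {A : Set (Fin d → ℕ)} (hA : A.Nonempty) : ∃ m ∈ A, ∀ x ∈ A, ¬ prec x m := by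
  obtain ⟨m, hm, hmin⟩ :=
    (measure fun x : Fin d → ℕ => {g | prec g x}.ncard).wf.has_min A hA
  refine ⟨m, hm, fun x hx hxm => hmin x hx ?_⟩
  refine Set.ncard_lt_ncard ⟨fun g hg => hprec.2.1 _ _ _ hg hxm, fun h => ?_⟩ (hfin m)
  exact hprec.1 x (h hxm)

/-- Every gap can be raised to a pseudo-Frobenius element by adding an element of `S`. -/
theorem exists_add_mem_pfSet {d : ℕ} {S : AddSubmonoid (Fin d → ℕ)}
    (hfull : coneN (S : Set (Fin d → ℕ)) = Set.univ)
    (hH : (Hset (S : Set (Fin d → ℕ))).Finite) {h : Fin d → ℕ}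
    (hh : h ∈ Hset (S : Set (Fin d → ℕ))) :
    ∃ s ∈ S, h + s ∈ pfSet (S : Set (Fin d → ℕ)) := by
  obtain ⟨f, hf⟩ := (hH.subset (t := {f ∈ Hset (S : Set (Fin d → ℕ)) | ∃ s ∈ S, h + s = f})
    (Set.sep_subset _ _)).exists_maximal ⟨h, hh, 0, S.zero_mem, add_zero h⟩
  obtain ⟨⟨hfH, s, hs, rfl⟩, hmax⟩ := hf
  refine ⟨s, hs, hfH, fun t ht ht0 => ?_⟩
  by_contra hcon
  have hlt : h + s < h + s + t := lt_add_of_pos_right _ (pos_iff_ne_zero.2 ht0)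
  refine hlt.not_ge (hmax ⟨⟨hfull ▸ Set.mem_univ _, hcon⟩, s + t, S.add_mem hs ht, ?_⟩ hlt.le)
  rw [add_assoc]

/-- In an almost symmetric semigroup, a gap `h` is a non-Frobenius pseudo-Frobenius element
unless `F - h` lies in `S`. -/
theorem AlmostSym.mem_pfSet_or_exists {d : ℕ} {S : AddSubmonoid (Fin d → ℕ)} {F : Fin d → ℕ}
    (hAS : AlmostSym (S : Set (Fin d → ℕ)) F)
    (hfull : coneN (S : Set (Fin d → ℕ)) = Set.univ)
    (hH : (Hset (S : Set (Fin d → ℕ))).Finite) {h : Fin d → ℕ}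
    (hh : h ∈ Hset (S : Set (Fin d → ℕ))) :
    h ∈ pfSet (S : Set (Fin d → ℕ)) \ {F} ∨ ∃ w ∈ S, h + w = F := by
  obtain ⟨s, hs, hf⟩ := exists_add_mem_pfSet hfull hH hh
  by_cases hF : h + s = F
  · exact Or.inr ⟨s, hs, hF⟩
  by_cases hs0 : s = 0
  · subst hs0
    rw [add_zero] at hf hF
    exact Or.inl ⟨hf, hF⟩
  · obtain ⟨w, hw, hwF⟩ := hAS.2 _ ⟨hf, hF⟩
    refine Or.inr ⟨w + s, hw.1.2 s hs hs0, ?_⟩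
    rw [← hwF]
    abel

theorem IsFrob.mem_pfSet {d : ℕ} {S : AddSubmonoid (Fin d → ℕ)} {F : Fin d → ℕ}
    {prec : (Fin d → ℕ) → (Fin d → ℕ) → Prop}
    (hF : IsFrob (S : Set (Fin d → ℕ)) prec F) (hprec : IsTermOrder prec)
    (hfin : ∀ x : Fin d → ℕ, {g | prec g x}.Finite)
    (hfull : coneN (S : Set (Fin d → ℕ)) = Set.univ) :
    F ∈ pfSet (S : Set (Fin d → ℕ)) := by
  refine ⟨hF.1, fun s _ hs0 => ?_⟩
  by_contra hcon
  have h1 : prec F (s + F) := by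
    simpa using hprec.2.2.2 _ _ F (hprec.zero_prec hfin hs0)
  rw [add_comm] at h1
  have h2 := hF.2 (F + s) ⟨hfull ▸ Set.mem_univ _, hcon⟩ (by simpa using hs0)
  exact hprec.1 _ (hprec.2.1 _ _ _ h1 h2)

/-- An almost symmetric semigroup has at most `n + t - 1` gaps, where `t` is the Betti-type and
`n` the number of elements preceding the Frobenius element. -/
theorem AlmostSym.ncard_Hset_lt {d : ℕ} {S : AddSubmonoid (Fin d → ℕ)} {F : Fin d → ℕ}
    {prec : (Fin d → ℕ) → (Fin d → ℕ) → Prop}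
    (hAS : AlmostSym (S : Set (Fin d → ℕ)) F)
    (hF : IsFrob (S : Set (Fin d → ℕ)) prec F) (hprec : IsTermOrder prec)
    (hfin : ∀ x : Fin d → ℕ, {g | prec g x}.Finite)
    (hfull : coneN (S : Set (Fin d → ℕ)) = Set.univ)
    (hH : (Hset (S : Set (Fin d → ℕ))).Finite) :
    (Hset (S : Set (Fin d → ℕ))).ncard <
      (pfSet (S : Set (Fin d → ℕ))).ncard + {g ∈ (S : Set (Fin d → ℕ)) | prec g F}.ncard := by
  have hpf : (pfSet (S : Set (Fin d → ℕ))).Finite := hH.subset fun f hf => hf.1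
  have hn : {g ∈ (S : Set (Fin d → ℕ)) | prec g F}.Finite := (hfin F).subset fun g hg => hg.2
  have hsub : Hset (S : Set (Fin d → ℕ)) ⊆ pfSet (S : Set (Fin d → ℕ)) \ {F} ∪
      (fun w => F - w) '' {g ∈ (S : Set (Fin d → ℕ)) | prec g F} := by
    intro h hh
    refine (hAS.mem_pfSet_or_exists hfull hH hh).imp id ?_
    rintro ⟨w, hw, rfl⟩
    have hh0 : h ≠ 0 := fun h0 => hh.2 (h0 ▸ S.zero_mem)
    refine ⟨w, ⟨hw, ?_⟩, by simp⟩
    simpa using hprec.2.2.2 _ _ w (hprec.zero_prec hfin hh0)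
  have h1 := Set.ncard_le_ncard hsub (hpf.sdiff.union (hn.image _))
  have h2 := Set.ncard_union_le (pfSet (S : Set (Fin d → ℕ)) \ {F})
    ((fun w => F - w) '' {g ∈ (S : Set (Fin d → ℕ)) | prec g F})
  have h3 := Set.ncard_image_le (f := fun w => F - w) hn
  have h4 := Set.ncard_sdiff_singleton_lt_of_mem (hF.mem_pfSet hprec hfin hfull) hpf
  omega

/-- If all nonzero elements of `S` exceed every gap, then there are at least two more minimal
generators than gaps. -/
theorem ncard_Hset_add_two_le {d : ℕ} (hd : 2 ≤ d) {S : AddSubmonoid (Fin d → ℕ)}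
    {prec : (Fin d → ℕ) → (Fin d → ℕ) → Prop} (hprec : IsTermOrder prec)
    (hfin : ∀ x : Fin d → ℕ, {g | prec g x}.Finite)
    (hS : ((S : Set (Fin d → ℕ))ᶜ).Finite)
    (hgens : (minGens (S : Set (Fin d → ℕ))).Finite)
    (hgap : ∀ s ∈ S, s ≠ 0 → ∀ h ∉ S, prec h s) :
    ((S : Set (Fin d → ℕ))ᶜ).ncard + 2 ≤ (minGens (S : Set (Fin d → ℕ))).ncard := by
  have hnt : Nontrivial (Fin d) := Fin.nontrivial_iff_two_le.2 hd
  have haxis : ∀ i : Fin d, ∃ k, k ≠ 0 ∧ Pi.single i k ∈ S := fun i => by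
    obtain ⟨N, hN⟩ := exists_single_mem hS i
    exact ⟨N + 1, by omega, hN _ (by omega)⟩
  obtain ⟨i, j, hij⟩ := hnt
  obtain ⟨k, hk0, hk⟩ := haxis i
  obtain ⟨l, hl0, hl⟩ := haxis j
  obtain ⟨m, ⟨hmS, hm0⟩, hmin⟩ := hprec.exists_min hfin
    (A := {s | s ∈ S ∧ s ≠ 0}) ⟨_, hk, by simpa⟩
  have hmgen : ∀ h ∈ insert 0 ((S : Set (Fin d → ℕ))ᶜ),
      m + h ∈ minGens (S : Set (Fin d → ℕ)) := by
    intro h hh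
    have hlt : ∀ s ∈ S, s ≠ 0 → prec h s := by
      rcases hh with rfl | hh
      · exact fun s _ hs0 => hprec.zero_prec hfin hs0
      · exact fun s hs hs0 => hgap s hs hs0 h hh
    refine ⟨?_, by simp [hm0], ?_⟩
    · by_contra hcon
      have h1 := hgap m hmS hm0 _ hcon
      rcases eq_or_ne h 0 with rfl | h0
      · exact hcon (by simpa using hmS)
      · have h2 := hprec.2.2.2 _ _ m (hprec.zero_prec hfin h0)
        rw [zero_add, add_comm] at h2
        exact hprec.1 _ (hprec.2.1 _ _ _ h2 h1)
    · rintro ⟨a, ha, b, hb, ha0, hb0, hab⟩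
      have h1 : prec (m + h) (m + b) := by
        simpa [add_comm] using hprec.2.2.2 _ _ m (hlt b hb hb0)
      rcases eq_or_ne m a with rfl | hma
      · exact hprec.1 _ (hab ▸ h1)
      · have h2 := hprec.2.2.2 _ _ b
          ((hprec.2.2.1 m a hma).resolve_right (hmin a ⟨ha, ha0⟩))
        exact hprec.1 _ (hprec.2.1 _ _ _ h1 (hab ▸ h2))
  have hnew : ∃ u ∈ minGens (S : Set (Fin d → ℕ)), ¬ m ≤ u := by
    by_contra! hcon
    obtain ⟨u, hu, hui⟩ := exists_minGens_le S _ hk (by simpa)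
    obtain ⟨v, hv, hvj⟩ := exists_minGens_le S _ hl (by simpa)
    refine hm0 (funext fun p => ?_)
    have h1 := ((hcon u hu).trans hui) p
    have h2 := ((hcon v hv).trans hvj) p
    by_cases hp : p = i
    · subst hp
      simpa [hij] using h2
    · simpa [hp] using h1
  obtain ⟨u, hu, hmu⟩ := hnew
  have hsub : insert u ((fun h => m + h) '' insert 0 ((S : Set (Fin d → ℕ))ᶜ)) ⊆
      minGens (S : Set (Fin d → ℕ)) := by
    rintro w (rfl | ⟨h, hh, rfl⟩)
    · exact hu
    · exact hmgen h hh
  refine le_trans (le_of_eq ?_) (Set.ncard_le_ncard hsub hgens)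
  rw [Set.ncard_insert_of_notMem _ ((hS.insert 0).image _),
    Set.ncard_image_of_injective _ (add_right_injective m),
    Set.ncard_insert_of_notMem _ hS]
  · simp
  · rintro ⟨h, -, rfl⟩
    exact hmu le_self_add

/-- Let `S` be a `≺`-almost symmetric `C`-semigroup in `ℕ^d` (`d ≥ 2`)
with full cone, where every element of `ℕ^d` is preceded by only finitely many elements.
If the Betti-type of `S` is three (`|PF(S)| = 3`), then `S` satisfies the extended Wilf
inequality `|{g ∈ S : g ≺ F}|·e(S) ≥ |H(S)| + |{g ∈ S : g ≺ F}| + 1`. -/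
theorem wilf_bettiType_three {d : ℕ} (hd : 2 ≤ d)
    (S : AddSubmonoid (Fin d → ℕ)) (hC : CSemigroup S)
    (hfull : coneN (S : Set (Fin d → ℕ)) = Set.univ)
    (prec : (Fin d → ℕ) → (Fin d → ℕ) → Prop) (hprec : IsTermOrder prec)
    (hfin : ∀ x : Fin d → ℕ, {g | prec g x}.Finite)
    (F : Fin d → ℕ) (hF : IsFrob (S : Set (Fin d → ℕ)) prec F)
    (hAS : AlmostSym (S : Set (Fin d → ℕ)) F)
    (hbetti : (pfSet (S : Set (Fin d → ℕ))).ncard = 3) :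
    (Hset (S : Set (Fin d → ℕ))).ncard +
        {g ∈ (S : Set (Fin d → ℕ)) | prec g F}.ncard + 1 ≤
      {g ∈ (S : Set (Fin d → ℕ)) | prec g F}.ncard *
        (minGens (S : Set (Fin d → ℕ))).ncard := by
  obtain ⟨hFG, -, hH⟩ := hC
  have hHS : Hset (S : Set (Fin d → ℕ)) = (S : Set (Fin d → ℕ))ᶜ := by
    rw [Hset, hfull, Set.compl_eq_univ_sdiff]
  have hgens := minGens_finite hFG
  have hn : {g ∈ (S : Set (Fin d → ℕ)) | prec g F}.Finite := (hfin F).subset fun g hg => hg.2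
  have hlt := hAS.ncard_Hset_lt hF hprec hfin hfull hH
  have hne : S ≠ ⊤ := fun h => hF.1.2 (h ▸ AddSubmonoid.mem_top F)
  have hF0 : F ≠ 0 := fun h => hF.1.2 (h ▸ S.zero_mem)
  have h0 : (0 : Fin d → ℕ) ∈ {g ∈ (S : Set (Fin d → ℕ)) | prec g F} :=
    ⟨S.zero_mem, hprec.zero_prec hfin hF0⟩
  by_cases hsmall : ∃ s ∈ S, s ≠ 0 ∧ prec s F
  · obtain ⟨s, hs, hs0, hsF⟩ := hsmall
    have htwo : 2 ≤ {g ∈ (S : Set (Fin d → ℕ)) | prec g F}.ncard := by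
      rw [← Set.ncard_pair hs0]
      refine Set.ncard_le_ncard ?_ hn
      rintro w (rfl | rfl)
      exacts [⟨hs, hsF⟩, h0]
    have hfour := four_le_ncard_minGens hd (hHS ▸ hH) hne hgens
    nlinarith
  · have hone : {g ∈ (S : Set (Fin d → ℕ)) | prec g F} = {0} := by
      refine Set.eq_singleton_iff_unique_mem.2 ⟨h0, fun g hg => ?_⟩
      by_contra hg0
      exact hsmall ⟨g, hg.1, hg0, hg.2⟩
    have hgap : ∀ s ∈ S, s ≠ 0 → ∀ h ∉ S, prec h s := by
      intro s hs hs0 h hh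
      have hFs : prec F s := (hprec.2.2.1 F s fun e => hF.1.2 (e ▸ hs)).resolve_right
        fun e => hsmall ⟨s, hs, hs0, e⟩
      rcases eq_or_ne h F with rfl | hhF
      · exact hFs
      · exact hprec.2.1 _ _ _ (hF.2 h (hHS ▸ hh) hhF) hFs
    have hge := ncard_Hset_add_two_le hd hprec hfin (hHS ▸ hH) hgens hgap
    rw [hone, Set.ncard_singleton, hHS]
    omega
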